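/- arXiv:2510.17485 — 2 statements merged into one kernel-verified Lean document; each statement's English description precedes it below -/
import Mathlib

section
/- Let n ∈ ℕ and let a_i > 0 and b_i > 0 for 1 ≤ i ≤ n. Then the family ((a_1 + k_1 b_1,…,a_n + k_n b_n)) indexed by (k_1,…,k_n) ∈ ℕ_0^n is a uniqueness sequence for the n-dimensional Laplace transform. -/
open MeasureTheory Filter Set

noncomputable section

/-- Partial Laplace integral of `f : [0,∞) → ℂ` at `l` up to time `t`. -/
def lapPartial (f : ℝ → ℂ) (l : ℂ) (t : ℝ) : ℂ :=
  ∫ s in Set.Ioc (0:ℝ) t, Complex.exp (-(l * s)) * f s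

/-- The Laplace transform of `f` at `l` exists and equals `F`. -/
def HasLaplace (f : ℝ → ℂ) (l : ℂ) (F : ℂ) : Prop :=
  Filter.Tendsto (lapPartial f l) Filter.atTop (nhds F)

/-- The abscissa of convergence of the Laplace transform of `f`, as an extended real. -/
def laplaceAbs (f : ℝ → ℂ) : EReal :=
  sInf {x : EReal | ∃ ω : ℝ, x = (ω : EReal) ∧ ∀ l : ℂ, ω < l.re → ∃ F, HasLaplace f l F}

/-- `lam` is a uniqueness sequence for the one-dimensional Laplace transform. -/
def IsUniquenessSeq (lam : ℕ → ℂ) : Prop :=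
  ∀ f : ℝ → ℂ, MeasureTheory.LocallyIntegrableOn f (Set.Ici 0) →
    (∀ k, laplaceAbs f < (((lam k).re : ℝ) : EReal)) →
    (∀ k, HasLaplace f (lam k) 0) →
    ∀ᵐ t : ℝ, 0 ≤ t → f t = 0

/-- Partial `n`-dimensional Laplace integral of `f : [0,∞)^n → ℂ` at `l` over the box `[0,t]`. -/
def mLapPartial (n : ℕ) (f : (Fin n → ℝ) → ℂ) (l : Fin n → ℂ) (t : Fin n → ℝ) : ℂ :=
  ∫ s in Set.pi Set.univ (fun i => Set.Ioc (0:ℝ) (t i)),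
    Complex.exp (-(∑ i, l i * (s i))) * f s

/-- The `n`-dimensional Laplace transform of `f` at `l` exists (as the iterated limit
`t₁ → ∞, …, tₙ → ∞` of the partial integrals) and equals `F`. -/
def HasMLaplace (n : ℕ) (f : (Fin n → ℝ) → ℂ) (l : Fin n → ℂ) (F : ℂ) : Prop :=
  Filter.Tendsto (mLapPartial n f l) Filter.atTop (nhds F)

/-- `Ω(f)`: the region of convergence of the `n`-dimensional Laplace integral. -/
def mOmega (n : ℕ) (f : (Fin n → ℝ) → ℂ) : Set (Fin n → ℂ) :=
  {l | ∃ F, HasMLaplace n f l F}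

/-- `Ω_b(f)`: the set of `l` for which the partial Laplace integrals are bounded. -/
def mOmegaB (n : ℕ) (f : (Fin n → ℝ) → ℂ) : Set (Fin n → ℂ) :=
  {l | Bornology.IsBounded (mLapPartial n f l '' {t | ∀ i, 0 ≤ t i})}

/-- A countable family `lam : K → ℂⁿ` is a uniqueness sequence for the `n`-dimensional
Laplace transform. -/
def IsMUniquenessFamily (n : ℕ) {K : Type} [Countable K] (lam : K → Fin n → ℂ) : Prop :=
  ∀ f : (Fin n → ℝ) → ℂ,
    MeasureTheory.LocallyIntegrableOn f {t | ∀ i, 0 ≤ t i} →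
    (∃ ω : Fin n → EReal, (∀ j, ω j ≠ ⊤) ∧
      {l : Fin n → ℂ | ∀ j, ω j < (((l j).re : ℝ) : EReal)} ⊆ mOmegaB n f ∩ mOmega n f ∧
      ∀ k j, ω j < ((((lam k j).re : ℝ)) : EReal)) →
    (∀ k, HasMLaplace n f (lam k) 0) →
    ∀ᵐ t : Fin n → ℝ, (∀ i, 0 ≤ t i) → f t = 0

open scoped BoundedContinuousFunction

/-- An integrable function whose integrals against all monomials in a point-separating finite family
of bounded continuous functions vanish is zero almost everywhere. -/
theorem ae_eq_zero_of_forall_integral_monomial_mul_eq_zero {E ι : Type*} [Fintype ι]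
    [MeasurableSpace E] [PseudoEMetricSpace E] [BorelSpace E] [CompleteSpace E]
    [SecondCountableTopology E] {μ : Measure E} (X : ι → E →ᵇ ℝ)
    (hX : ∀ x y, x ≠ y → ∃ i, X i x ≠ X i y) {h : E → ℝ} (hh : Integrable h μ)
    (hint : ∀ m : ι → ℕ, ∫ u, (∏ i, X i u ^ m i) * h u ∂μ = 0) : h =ᵐ[μ] 0 := by
  have hfin := isFiniteMeasure_withDensity_ofReal hh.2
  have hfin' := isFiniteMeasure_withDensity_ofReal hh.neg.2
  have hm : AEMeasurable (fun u => ENNReal.ofReal (h u)) μ := hh.aemeasurable.ennreal_ofReal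
  have hm' : AEMeasurable (fun u => ENNReal.ofReal ((-h) u)) μ := hh.neg.aemeasurable.ennreal_ofReal
  have hbdd (g : E →ᵇ ℝ) {k : E → ℝ} (hk : Integrable k μ) :
      Integrable (fun u => g u * k u) μ :=
    hk.bdd_mul (c := ‖g‖) g.continuous.aestronglyMeasurable (ae_of_all _ g.norm_coe_le_norm)
  have hzero (p : MvPolynomial ι ℝ) : ∫ u, (MvPolynomial.aeval X p : E →ᵇ ℝ) u * h u ∂μ = 0 := by
    induction p using MvPolynomial.induction_on' with
    | monomial m c =>
      have hmon (u : E) : (MvPolynomial.aeval X (MvPolynomial.monomial m c) : E →ᵇ ℝ) u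
          = c * ∏ i, X i u ^ m i := by
        rw [MvPolynomial.aeval_monomial, Finsupp.prod_fintype _ _ (by simp)]
        simp [Algebra.algebraMap_eq_smul_one]
      simp_rw [hmon, mul_assoc, integral_const_mul, hint, mul_zero]
    | add p q hp hq =>
      simp_rw [map_add, BoundedContinuousFunction.add_apply, add_mul]
      rw [integral_add (hbdd _ hh) (hbdd _ hh), hp, hq, add_zero]
  let A : StarSubalgebra ℝ (E →ᵇ ℝ) :=
    { (MvPolynomial.aeval X : MvPolynomial ι ℝ →ₐ[ℝ] (E →ᵇ ℝ)).range with
      star_mem' := fun {a} ha => by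
        rwa [show star a = a from BoundedContinuousFunction.ext fun u => star_trivial (a u)] }
  have hmeas : μ.withDensity (fun u => ENNReal.ofReal (h u))
      = μ.withDensity (fun u => ENNReal.ofReal ((-h) u)) := by
    refine ext_of_forall_mem_subalgebra_integral_eq_of_pseudoEMetric_complete_countable (𝕜 := ℝ)
      (A := A) ?_ ?_
    · intro x y hxy
      obtain ⟨i, hi⟩ := hX x y hxy
      exact ⟨X i, ⟨(X i).toContinuousMap, ⟨X i, ⟨MvPolynomial.X i, by simp⟩, rfl⟩, rfl⟩, hi⟩
    · rintro _ ⟨p, rfl⟩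
      rw [integral_withDensity_eq_integral_toReal_smul₀ hm (by simp),
        integral_withDensity_eq_integral_toReal_smul₀ hm' (by simp), ← sub_eq_zero,
        ← integral_sub, ← hzero p]
      · refine integral_congr_ae (ae_of_all _ fun u => ?_)
        simp only [ENNReal.toReal_ofReal', smul_eq_mul, Pi.neg_apply, ← sub_mul]
        rw [max_zero_sub_max_neg_zero_eq_self, mul_comm]
        rfl
      · simp only [ENNReal.toReal_ofReal', smul_eq_mul, mul_comm (max _ _)]
        exact hbdd _ hh.pos_part
      · simp only [ENNReal.toReal_ofReal', smul_eq_mul, mul_comm (max _ _)]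
        exact hbdd _ hh.neg_part
  have hlt : ∫⁻ u, ENNReal.ofReal (h u) ∂μ ≠ ⊤ := hh.lintegral_lt_top.ne
  filter_upwards [(withDensity_eq_iff hm hm' hlt).1 hmeas] with u hu
  have := congrArg ENNReal.toReal hu
  simp only [ENNReal.toReal_ofReal', Pi.neg_apply] at this
  have h3 := max_zero_sub_max_neg_zero_eq_self (h u)
  rw [this, sub_self] at h3
  exact h3.symm

/-- An integrable function on `ℝⁿ` whose integrals over all lower orthants `Iic t` vanish, as well as
its total integral, is zero almost everywhere. -/
theorem ae_eq_zero_of_forall_setIntegral_pi_Iic_eq_zero {ι : Type*} [Fintype ι]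
    {G : (ι → ℝ) → ℂ} (hG : Integrable G) (htot : ∫ u, G u = 0)
    (hIic : ∀ t, ∫ u in Iic t, G u = 0) : G =ᵐ[volume] 0 := by
  refine hG.ae_eq_zero_of_forall_setIntegral_eq_zero fun s hs hlt => ?_
  clear hlt
  have hspan : IsCountablySpanning (range (Iic : ℝ → Set ℝ)) :=
    ⟨fun n : ℕ => Iic (n : ℝ), fun n => ⟨n, rfl⟩, iUnion_eq_univ_iff.2 fun x => exists_nat_ge x⟩
  have hgen : (inferInstance : MeasurableSpace (ι → ℝ)) = MeasurableSpace.generateFrom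
      (pi univ '' pi univ fun _ : ι => range (Iic : ℝ → Set ℝ)) := by
    rw [← generateFrom_pi_eq fun _ : ι => hspan, ← borel_eq_generateFrom_Iic,
      ← BorelSpace.measurable_eq]
  induction s, hs using MeasurableSpace.induction_on_inter hgen
    (IsPiSystem.pi fun _ => isPiSystem_Iic) with
  | empty => simp
  | basic s hs =>
    obtain ⟨S, hS, rfl⟩ := hs
    choose t ht using fun i => hS i (mem_univ i)
    rw [← funext ht, pi_univ_Iic]
    exact hIic t
  | compl s hs ih => rw [setIntegral_compl hs hG, htot, ih, sub_zero]
  | iUnion s hd hm ih => simp [integral_iUnion hm hd hG.integrableOn, ih]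

/-- The half-open box `∏ (0, tᵢ]`. -/
abbrev posBox {ι : Type*} (t : ι → ℝ) : Set (ι → ℝ) := pi univ fun i => Ioc (0 : ℝ) (t i)

theorem measurableSet_posBox {ι : Type*} [Countable ι] (t : ι → ℝ) : MeasurableSet (posBox t) :=
  .univ_pi fun _ => measurableSet_Ioc

theorem posBox_of_not_nonneg {ι : Type*} {t : ι → ℝ} (ht : ¬∀ i, 0 ≤ t i) : posBox t = ∅ := by
  push Not at ht
  obtain ⟨i, hi⟩ := ht
  exact univ_pi_eq_empty (i := i) (Ioc_eq_empty (not_lt.2 hi.le))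

theorem posBox_inf {ι : Type*} (t u : ι → ℝ) : posBox (t ⊓ u) = posBox t ∩ Iic u := by
  ext s
  simp only [Set.mem_pi, mem_univ, true_implies, mem_Ioc, Pi.inf_apply, le_inf_iff, mem_inter_iff,
    mem_Iic, Pi.le_def, ← forall_and, and_assoc]

/-- The density of a product of exponential distributions with rates `r i`. -/
def expDensity {ι : Type*} [Fintype ι] (r u : ι → ℝ) : ℝ :=
  ∏ i, (Ioi (0 : ℝ)).indicator (fun x => r i * Real.exp (-r i * x)) (u i)

section

variable {ι : Type*} [Fintype ι] {r : ι → ℝ}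

theorem integrable_expDensity (hr : ∀ i, 0 < r i) : Integrable (expDensity r) :=
  Integrable.fintype_prod fun i =>
    (integrable_indicator_iff measurableSet_Ioi).2
      ((exp_neg_integrableOn_Ioi 0 (hr i)).const_mul (r i))

theorem expDensity_of_pos {u : ι → ℝ} (hu : ∀ i, 0 < u i) :
    expDensity r u = ∏ i, (r i * Real.exp (-r i * u i)) :=
  Finset.prod_congr rfl fun i _ => indicator_of_mem (hu i) _

theorem expDensity_of_not_pos {u : ι → ℝ} (hu : ¬∀ i, 0 < u i) : expDensity r u = 0 := by
  push Not at hu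
  obtain ⟨i, hi⟩ := hu
  exact Finset.prod_eq_zero (Finset.mem_univ i) (indicator_of_notMem (not_lt.2 hi) _)

theorem expDensity_pos {u : ι → ℝ} (hr : ∀ i, 0 < r i) (hu : ∀ i, 0 < u i) :
    0 < expDensity r u := by
  rw [expDensity_of_pos hu]
  exact Finset.prod_pos fun i _ => mul_pos (hr i) (Real.exp_pos _)

theorem setIntegral_Ici_expDensity (hr : ∀ i, 0 < r i) {s : ι → ℝ} (hs : ∀ i, 0 < s i) :
    ∫ u in Ici s, expDensity r u = Real.exp (-∑ i, r i * s i) := by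
  have h1 (i : ι) : ∫ x in Ici (s i), (Ioi (0 : ℝ)).indicator
      (fun x => r i * Real.exp (-r i * x)) x = Real.exp (-(r i * s i)) := by
    rw [integral_Ici_eq_integral_Ioi, setIntegral_congr_fun (g := fun x => r i * Real.exp (-r i * x))
      measurableSet_Ioi fun x hx => indicator_of_mem (lt_trans (hs i) hx) _, integral_const_mul,
      integral_exp_mul_Ioi (neg_lt_zero.2 (hr i))]
    have := (hr i).ne'
    field_simp
  simp only [expDensity]
  rw [← pi_univ_Ici, volume_pi, Measure.restrict_pi_pi, integral_fintype_prod_eq_prod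
      (f := fun i => (Ioi (0 : ℝ)).indicator (fun x => r i * Real.exp (-r i * x)))]
  simp_rw [h1, ← Real.exp_sum, Finset.sum_neg_distrib]

variable {g : (ι → ℝ) → ℂ} {t : ι → ℝ}

theorem integrable_prod_indicator_le_expDensity (hr : ∀ i, 0 < r i)
    (hg : IntegrableOn g (posBox t)) :
    Integrable (fun p : (ι → ℝ) × (ι → ℝ) =>
      (Iic p.2).indicator (fun s => (expDensity r p.2 : ℂ) * g s) p.1)
      ((volume.restrict (posBox t)).prod volume) := by
  have := ((hg.mul_prod (integrable_expDensity hr).ofReal).indicator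
    (measurableSet_le measurable_fst measurable_snd :
      MeasurableSet {p : (ι → ℝ) × (ι → ℝ) | p.1 ≤ p.2}))
  refine this.congr (ae_of_all _ fun p => ?_)
  simp only [indicator, mem_ofPred_eq, mem_Iic, mul_comm]
  rfl

theorem setIntegral_indicator_le_expDensity (u : ι → ℝ) :
    ∫ s in posBox t, (Iic u).indicator (fun s => (expDensity r u : ℂ) * g s) s
      = expDensity r u * ∫ s in posBox (t ⊓ u), g s := by
  rw [setIntegral_indicator measurableSet_Iic, posBox_inf, integral_const_mul]

theorem integrable_expDensity_mul_setIntegral_posBox (hr : ∀ i, 0 < r i)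
    (hg : IntegrableOn g (posBox t)) :
    Integrable fun u => (expDensity r u : ℂ) * ∫ s in posBox (t ⊓ u), g s := by
  have := (integrable_prod_indicator_le_expDensity hr hg).integral_prod_right
  simpa only [setIntegral_indicator_le_expDensity] using this

/-- The Laplace integral over a box as an integral of the primitive of `g` against an
exponential density; this plays the role of integration by parts in each variable. -/
theorem setIntegral_exp_mul_eq_integral_expDensity_mul (hr : ∀ i, 0 < r i)
    (hg : IntegrableOn g (posBox t)) :
    ∫ s in posBox t, (Real.exp (-∑ i, r i * s i) : ℂ) * g s
      = ∫ u, (expDensity r u : ℂ) * ∫ s in posBox (t ⊓ u), g s := by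
  simp_rw [← setIntegral_indicator_le_expDensity]
  rw [← integral_integral_swap (f := fun s u =>
    (Iic u).indicator (fun s => (expDensity r u : ℂ) * g s) s)
    (integrable_prod_indicator_le_expDensity hr hg)]
  refine setIntegral_congr_fun (measurableSet_posBox t) fun s hs => ?_
  have hi (u : ι → ℝ) : (Iic u).indicator (fun s => (expDensity r u : ℂ) * g s) s
      = (Ici s).indicator (fun u => (expDensity r u : ℂ) * g s) u := by
    by_cases h : s ≤ u <;> simp [h]
  simp_rw [hi]
  rw [integral_indicator measurableSet_Ici, integral_mul_const, integral_complex_ofReal,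
    setIntegral_Ici_expDensity hr fun i => (hs i (mem_univ i)).1]

theorem tendsto_natCast_const_atTop :
    Tendsto (fun (N : ℕ) (_ : ι) => (N : ℝ)) atTop atTop :=
  tendsto_atTop.2 fun u =>
    eventually_all.2 fun i => tendsto_natCast_atTop_atTop.eventually_ge_atTop (u i)

theorem eventually_natCast_inf_eq (u : ι → ℝ) :
    ∀ᶠ N : ℕ in atTop, (fun _ => (N : ℝ)) ⊓ u = u := by
  filter_upwards [tendsto_natCast_const_atTop.eventually_ge_atTop u] with N hN
  exact inf_eq_right.2 hN

/-- If the primitive of `g` is bounded, the Laplace integrals of `g` over growing boxes converge to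
the integral of the primitive against the exponential density. -/
theorem tendsto_setIntegral_exp_mul (hr : ∀ i, 0 < r i)
    (hg : ∀ t, IntegrableOn g (posBox t)) {M : ℝ} (hM : ∀ t, ‖∫ s in posBox t, g s‖ ≤ M) :
    (Integrable fun u => (expDensity r u : ℂ) * ∫ s in posBox u, g s) ∧
    Tendsto (fun N : ℕ => ∫ s in posBox fun _ => (N : ℝ), (Real.exp (-∑ i, r i * s i) : ℂ) * g s)
      atTop (nhds (∫ u, (expDensity r u : ℂ) * ∫ s in posBox u, g s)) := by
  have hmeas (N : ℕ) := (integrable_expDensity_mul_setIntegral_posBox hr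
    (hg fun _ => (N : ℝ))).aestronglyMeasurable
  have hlim (u : ι → ℝ) : Tendsto (fun N : ℕ => (expDensity r u : ℂ) *
      ∫ s in posBox ((fun _ => (N : ℝ)) ⊓ u), g s) atTop
      (nhds ((expDensity r u : ℂ) * ∫ s in posBox u, g s)) :=
    tendsto_const_nhds.congr' (by
      filter_upwards [eventually_natCast_inf_eq u] with N hN
      rw [hN])
  have hbound (u t : ι → ℝ) : ‖(expDensity r u : ℂ) * ∫ s in posBox t, g s‖
      ≤ ‖expDensity r u‖ * M := by
    rw [norm_mul, Complex.norm_real]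
    gcongr
    exact hM t
  have hdom := (integrable_expDensity hr).norm.mul_const M
  refine ⟨hdom.mono' (aestronglyMeasurable_of_tendsto_ae atTop hmeas (ae_of_all _ hlim))
    (ae_of_all _ fun u => hbound u u), ?_⟩
  simp_rw [fun N : ℕ => setIntegral_exp_mul_eq_integral_expDensity_mul hr
    (hg fun _ => (N : ℝ))]
  exact tendsto_integral_of_dominated_convergence _ hmeas hdom
    (fun N => ae_of_all _ fun u => hbound u _) (ae_of_all _ hlim)

/-- A bounded continuous injective function on `ℝ` that equals `exp (-b x)` for `x ≥ 0`. -/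
def foldedExp (b x : ℝ) : ℝ := Real.exp (-b * max x 0) + 1 - Real.exp (b * min x 0)

theorem foldedExp_of_nonneg (b : ℝ) {x : ℝ} (hx : 0 ≤ x) : foldedExp b x = Real.exp (-b * x) := by
  simp [foldedExp, hx]

theorem continuous_foldedExp (b : ℝ) : Continuous (foldedExp b) := by
  unfold foldedExp
  fun_prop

theorem strictAnti_foldedExp {b : ℝ} (hb : 0 < b) : StrictAnti (foldedExp b) := by
  intro x y hxy
  have hmax : Real.exp (-b * max y 0) ≤ Real.exp (-b * max x 0) :=
    Real.exp_le_exp.2 (mul_le_mul_of_nonpos_left (max_le_max_right 0 hxy.le) (by linarith))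
  have hmin : Real.exp (b * min x 0) ≤ Real.exp (b * min y 0) := by gcongr
  unfold foldedExp
  rcases lt_or_ge x 0 with hx | hx
  · have : Real.exp (b * min x 0) < Real.exp (b * min y 0) := by
      have : min x 0 < min y 0 := by
        rw [min_eq_left hx.le]
        exact lt_min hxy hx
      gcongr
    linarith
  · have : Real.exp (-b * max y 0) < Real.exp (-b * max x 0) := by
      rw [max_eq_left hx, max_eq_left (hx.trans hxy.le)]
      exact Real.exp_lt_exp.2 (mul_lt_mul_of_neg_left hxy (by linarith))
    linarith

theorem norm_foldedExp_le {b : ℝ} (hb : 0 < b) (x : ℝ) : ‖foldedExp b x‖ ≤ 2 := by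
  have h1 : Real.exp (-b * max x 0) ≤ 1 :=
    Real.exp_le_one_iff.2 (mul_nonpos_of_nonpos_of_nonneg (by linarith) (le_max_right _ _))
  have h2 : Real.exp (b * min x 0) ≤ 1 :=
    Real.exp_le_one_iff.2 (mul_nonpos_of_nonneg_of_nonpos hb.le (min_le_right _ _))
  have h3 := Real.exp_pos (-b * max x 0)
  have h4 := Real.exp_pos (b * min x 0)
  rw [Real.norm_eq_abs, abs_le, foldedExp]
  constructor <;> linarith

theorem expDensity_nat_mul (b : ι → ℝ) (m : ι → ℕ) (u : ι → ℝ) :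
    expDensity (fun i => ((m i : ℝ) + 1) * b i) u
      = (∏ i, ((m i : ℝ) + 1)) * ((∏ i, foldedExp (b i) (u i) ^ m i) * expDensity b u) := by
  by_cases hu : ∀ i, 0 < u i
  · rw [expDensity_of_pos hu, expDensity_of_pos hu, ← Finset.prod_mul_distrib,
      ← Finset.prod_mul_distrib]
    refine Finset.prod_congr rfl fun i _ => ?_
    rw [foldedExp_of_nonneg _ (hu i).le, ← Real.exp_nat_mul,
      show -(((m i : ℝ) + 1) * b i) * u i = (m i : ℝ) * (-b i * u i) + -b i * u i by ring,
      Real.exp_add]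
    ring
  · simp [expDensity_of_not_pos hu]

/-- A function is zero almost everywhere on the positive orthant if its integrals against the
exponential densities with rates in the positive integer multiples of `b` all vanish. -/
theorem ae_eq_zero_of_forall_integral_expDensity_mul_eq_zero {b : ι → ℝ} (hb : ∀ i, 0 < b i)
    {F : (ι → ℝ) → ℂ} (hF : Integrable fun u => (expDensity b u : ℂ) * F u)
    (hint : ∀ m : ι → ℕ,
      ∫ u, (expDensity (fun i => ((m i : ℝ) + 1) * b i) u : ℂ) * F u = 0) :
    ∀ᵐ u : ι → ℝ, (∀ i, 0 < u i) → F u = 0 := by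
  let X (i : ι) : (ι → ℝ) →ᵇ ℝ :=
    BoundedContinuousFunction.ofNormedAddCommGroup (fun u => foldedExp (b i) (u i))
      ((continuous_foldedExp (b i)).comp (continuous_apply i)) 2
      fun u => norm_foldedExp_le (hb i) (u i)
  have hX (x y : ι → ℝ) (hxy : x ≠ y) : ∃ i, X i x ≠ X i y := by
    obtain ⟨i, hi⟩ := Function.ne_iff.1 hxy
    exact ⟨i, fun h => hi ((strictAnti_foldedExp (hb i)).injective h)⟩
  set h : (ι → ℝ) → ℂ := fun u => (expDensity b u : ℂ) * F u with hh
  have hmono (m : ι → ℕ) : ∫ u, ((∏ i, X i u ^ m i : ℝ) : ℂ) * h u = 0 := by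
    have h0 := hint m
    simp_rw [expDensity_nat_mul, Complex.ofReal_mul, mul_assoc, integral_const_mul] at h0
    refine (mul_eq_zero.1 h0).resolve_left ?_
    exact Complex.ofReal_ne_zero.2 (Finset.prod_pos fun i _ => by positivity).ne'
  have hmint (m : ι → ℕ) : Integrable fun u => ((∏ i, X i u ^ m i : ℝ) : ℂ) * h u := by
    refine hF.bdd_mul (c := ∏ i, 2 ^ m i) (Continuous.aestronglyMeasurable ?_)
      (ae_of_all _ fun u => ?_)
    · exact Complex.continuous_ofReal.comp
        (continuous_finsetProd _ fun i _ => (X i).continuous.pow _)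
    · rw [Complex.norm_real, norm_prod]
      refine Finset.prod_le_prod (fun i _ => norm_nonneg _) fun i _ => ?_
      rw [norm_pow]
      exact pow_le_pow_left₀ (norm_nonneg _) (norm_foldedExp_le (hb i) (u i)) _
  have hre := ae_eq_zero_of_forall_integral_monomial_mul_eq_zero X hX hF.re fun m => by
    have := congrArg Complex.re (hmono m)
    rw [← RCLike.re_eq_complex_re, ← integral_re (hmint m)] at this
    simpa only [RCLike.re_eq_complex_re, Complex.re_ofReal_mul, Complex.zero_re] using this
  have him := ae_eq_zero_of_forall_integral_monomial_mul_eq_zero X hX hF.im fun m => by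
    have := congrArg Complex.im (hmono m)
    rw [← RCLike.im_eq_complex_im, ← integral_im (hmint m)] at this
    simpa only [RCLike.im_eq_complex_im, Complex.im_ofReal_mul, Complex.zero_im] using this
  filter_upwards [hre, him] with u hu hu' hpos
  have hz : h u = 0 := Complex.ext hu hu'
  exact (mul_eq_zero.1 hz).resolve_left (Complex.ofReal_ne_zero.2 (expDensity_pos hb hpos).ne')

/-- A primitive vanishing almost everywhere on the positive orthant vanishes everywhere. -/
theorem setIntegral_posBox_eq_zero_of_ae (hg : ∀ t, IntegrableOn g (posBox t))
    (hae : ∀ᵐ u : ι → ℝ, (∀ i, 0 < u i) → ∫ s in posBox u, g s = 0) (t : ι → ℝ) :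
    ∫ s in posBox t, g s = 0 := by
  by_cases ht : ∀ i, 0 ≤ t i
  swap
  · simp [posBox_of_not_nonneg ht]
  have hex (N : ℕ) : ∃ v : ι → ℝ, (∀ i, v i ∈ Ioo (t i) (t i + 1 / ((N : ℝ) + 1))) ∧
      ∫ s in posBox v, g s = 0 := by
    have hN : (0 : ℝ) < 1 / ((N : ℝ) + 1) := by positivity
    have hpos : volume (pi univ fun i => Ioo (t i) (t i + 1 / ((N : ℝ) + 1))) ≠ 0 := by
      refine (IsOpen.measure_pos _ (isOpen_set_pi finite_univ fun i _ => isOpen_Ioo) ?_).ne'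
      exact univ_pi_nonempty_iff.2 fun i => nonempty_Ioo.2 (by linarith)
    obtain ⟨v, hv, hv'⟩ := (frequently_ae_mem_iff.2 hpos).and_eventually hae |>.exists
    exact ⟨v, fun i => hv i (mem_univ i),
      hv' fun i => (ht i).trans_lt (hv i (mem_univ i)).1⟩
  choose v hv hv0 using hex
  have hvlim (i : ι) : Tendsto (fun N => v N i) atTop (nhds (t i)) := by
    refine tendsto_of_tendsto_of_tendsto_of_le_of_le tendsto_const_nhds ?_
      (fun N => (hv N i).1.le) (fun N => (hv N i).2.le)
    simpa using tendsto_one_div_add_atTop_nhds_zero_nat.const_add (t i)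
  have hlim : Tendsto (fun N => ∫ s, (posBox (v N)).indicator g s) atTop
      (nhds (∫ s, (posBox t).indicator g s)) := by
    refine tendsto_integral_of_dominated_convergence
      (fun s => ‖(posBox fun i => t i + 1).indicator g s‖) (fun N => ?_) ?_ (fun N => ?_) ?_
    · exact ((integrable_indicator_iff (measurableSet_posBox _)).2 (hg _)).aestronglyMeasurable
    · exact ((integrable_indicator_iff (measurableSet_posBox _)).2 (hg _)).norm
    · refine ae_of_all _ fun s => norm_indicator_le_of_subset (Set.pi_mono fun i _ => ?_) _ _
      refine Ioc_subset_Ioc_right ((hv N i).2.le.trans (add_le_add_right ?_ _))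
      exact (div_le_one (by positivity)).2 (by linarith [(Nat.cast_nonneg N : (0 : ℝ) ≤ N)])
    · refine ae_of_all _ fun s => ?_
      by_cases hs : s ∈ posBox t
      · refine tendsto_const_nhds.congr fun N => ?_
        rw [indicator_of_mem hs, indicator_of_mem]
        exact fun i hi => ⟨(hs i hi).1, (hs i hi).2.trans (hv N i).1.le⟩
      · rw [indicator_of_notMem hs]
        simp only [Set.mem_pi, mem_univ, true_implies, not_forall] at hs
        obtain ⟨i, hi⟩ := hs
        refine tendsto_const_nhds.congr' ?_
        by_cases h0 : 0 < s i
        · have hlt : t i < s i := not_le.1 fun h => hi ⟨h0, h⟩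
          filter_upwards [(hvlim i).eventually_lt_const hlt] with N hN
          exact (indicator_of_notMem (fun h => hN.not_ge (h i (mem_univ i)).2) _).symm
        · exact Eventually.of_forall fun N =>
            (indicator_of_notMem (fun h => h0 (h i (mem_univ i)).1) _).symm
  simp_rw [integral_indicator (measurableSet_posBox _), hv0] at hlim
  exact (tendsto_nhds_unique hlim tendsto_const_nhds)

theorem ae_eq_zero_of_forall_setIntegral_posBox_eq_zero (hg : ∀ t, IntegrableOn g (posBox t))
    (hzero : ∀ t, ∫ s in posBox t, g s = 0) : ∀ᵐ s : ι → ℝ, (∀ i, 0 < s i) → g s = 0 := by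
  have hbox (N : ℕ) : (posBox fun _ : ι => (N : ℝ)).indicator g =ᵐ[volume] 0 := by
    refine ae_eq_zero_of_forall_setIntegral_pi_Iic_eq_zero
      ((integrable_indicator_iff (measurableSet_posBox _)).2 (hg _)) ?_ fun t => ?_
    · rw [integral_indicator (measurableSet_posBox _), hzero]
    · rw [setIntegral_indicator (measurableSet_posBox _), inter_comm, ← posBox_inf, hzero]
  filter_upwards [ae_all_iff.2 hbox] with s hs hpos
  obtain ⟨N, hN⟩ := (tendsto_natCast_const_atTop.eventually_ge_atTop s).exists
  have := hs N
  rwa [indicator_of_mem (fun i _ => ⟨hpos i, hN i⟩)] at this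

end

theorem stmt5 (n : ℕ) (a b : Fin n → ℝ) (ha : ∀ i, 0 < a i) (hb : ∀ i, 0 < b i) :
    IsMUniquenessFamily n
      (fun (k : Fin n → ℕ) j => (((a j + (k j : ℝ) * b j : ℝ)) : ℂ)) := by
  rintro f hf ⟨ω, -, hsub, hω⟩ hzero
  set g : (Fin n → ℝ) → ℂ := fun s => Complex.exp (-∑ i, (a i : ℂ) * s i) * f s with hgdef
  have hg (t : Fin n → ℝ) : IntegrableOn g (posBox t) := by
    have hsubset : posBox t ⊆ Icc 0 t := fun s hs =>
      ⟨fun i => (hs i (mem_univ i)).1.le, fun i => (hs i (mem_univ i)).2⟩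
    refine IntegrableOn.mono_set ?_ hsubset
    refine IntegrableOn.continuousOn_mul (Continuous.continuousOn (by fun_prop)) ?_ isCompact_Icc
    exact hf.integrableOn_compact_subset (fun s hs i => hs.1 i) isCompact_Icc
  obtain ⟨M, hM⟩ : ∃ M, ∀ t, ‖∫ s in posBox t, g s‖ ≤ M := by
    have hmem : (fun j => (a j : ℂ)) ∈ mOmegaB n f := by
      refine (hsub fun j => ?_).1
      simpa using hω 0 j
    obtain ⟨M, hM⟩ := Bornology.IsBounded.exists_norm_le
      (s := mLapPartial n f (fun j => (a j : ℂ)) '' {t | ∀ i, 0 ≤ t i}) hmem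
    refine ⟨max M 0, fun t => ?_⟩
    by_cases ht : ∀ i, 0 ≤ t i
    · exact (hM _ ⟨t, ht, rfl⟩).trans (le_max_left _ _)
    · simp [posBox_of_not_nonneg ht]
  have hprim : ∀ᵐ u : Fin n → ℝ, (∀ i, 0 < u i) → ∫ s in posBox u, g s = 0 := by
    refine ae_eq_zero_of_forall_integral_expDensity_mul_eq_zero hb
      (tendsto_setIntegral_exp_mul hb hg hM).1 fun m => ?_
    have hlim := (tendsto_setIntegral_exp_mul (r := fun i => ((m i : ℝ) + 1) * b i)
      (fun i => mul_pos (by positivity) (hb i)) hg hM).2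
    refine tendsto_nhds_unique hlim (((hzero fun i => m i + 1).comp
      tendsto_natCast_const_atTop).congr fun N => ?_)
    simp only [Function.comp_apply, mLapPartial]
    refine integral_congr_ae (ae_of_all _ fun s => ?_)
    simp only [hgdef]
    rw [← mul_assoc, Complex.ofReal_exp, ← Complex.exp_add]
    congr 2
    push_cast
    rw [← neg_add, ← Finset.sum_add_distrib]
    congr 1
    exact Finset.sum_congr rfl fun i _ => by ring
  have hne : ∀ᵐ s : Fin n → ℝ, ∀ i, s i ≠ 0 :=
    ae_all_iff.2 fun i => Measure.ae_eval_ne _ i 0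
  filter_upwards [hne, ae_eq_zero_of_forall_setIntegral_posBox_eq_zero hg
    (setIntegral_posBox_eq_zero_of_ae hg hprim)] with s hs hs0 hnonneg
  exact (mul_eq_zero.1 (hs0 fun i => (hnonneg i).lt_of_ne' (hs i))).resolve_left
    (Complex.exp_ne_zero _)


end
end

section
/- Let n ∈ ℕ and for each j = 1,…,n let (λ_k^j)_{k∈ℕ} be a sequence of complex numbers with Re λ_k^j > 0 for all k ∈ ℕ. Then (λ_k^1)_{k∈ℕ},…,(λ_k^n)_{k∈ℕ} are all uniqueness sequences for the (one-dimensional) Laplace transform if and only if the family ((λ_{k_1}^1,…,λ_{k_n}^n)) indexed by (k_1,…,k_n) ∈ ℕ^n is a uniqueness sequence for the n-dimensional Laplace transform. -/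
open MeasureTheory Filter Set

noncomputable section

/-- Lebesgue measure on the open half-line `(0,∞)`. -/
abbrev halfLine : Measure ℝ := volume.restrict (Ioi (0:ℝ))

/-- Lebesgue measure on the open orthant `(0,∞)^n`. -/
abbrev orthant (n : ℕ) : Measure (Fin n → ℝ) := Measure.pi fun _ => halfLine

/-- The half-open box `(0,t]`. -/
abbrev box {n : ℕ} (t : Fin n → ℝ) : Set (Fin n → ℝ) :=
  Set.pi Set.univ (fun i => Set.Ioc (0:ℝ) (t i))

lemma measurableSet_box {n : ℕ} (t : Fin n → ℝ) : MeasurableSet (box t) :=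
  MeasurableSet.univ_pi fun _ => measurableSet_Ioc

lemma orthant_eq_restrict (n : ℕ) :
    orthant n = (volume : Measure (Fin n → ℝ)).restrict (Set.pi Set.univ fun _ => Ioi (0:ℝ)) := by
  rw [volume_pi, Measure.restrict_pi_pi]

lemma box_inter_Iic {n : ℕ} (r T : Fin n → ℝ) : box T ∩ Iic r = box (r ⊓ T) := by
  ext s
  simp only [mem_inter_iff, mem_univ_pi, mem_Ioc, mem_Iic, Pi.le_def, Pi.inf_apply, le_inf_iff]
  grind

/-- Fubini's theorem for a product of tail integrals against `g` on a box. -/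
lemma setIntegral_box_prod_tail_mul {n : ℕ} {g : (Fin n → ℝ) → ℂ} {T : Fin n → ℝ}
    (hg : IntegrableOn g (box T)) {k : Fin n → ℝ → ℂ} (hk : ∀ j, Integrable (k j) halfLine) :
    ∫ s in box T, (∏ j, ∫ r in Ici (s j), k j r) * g s =
      ∫ r, (∏ j, k j (r j)) * (∫ s in box (r ⊓ T), g s) ∂orthant n := by
  have hK : Integrable (fun r : Fin n → ℝ => ∏ j, k j (r j)) (orthant n) :=
    Integrable.fintype_prod hk
  have hmeas : MeasurableSet {z : (Fin n → ℝ) × (Fin n → ℝ) | z.1 ≤ z.2} :=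
    measurableSet_le measurable_fst measurable_snd
  have hint : Integrable (Function.uncurry fun s r : Fin n → ℝ =>
      (Iic r).indicator (fun s => g s * ∏ j, k j (r j)) s)
      ((volume.restrict (box T)).prod (orthant n)) := by
    refine ((hg.mul_prod hK).indicator hmeas).congr (.of_forall fun z => ?_)
    rfl
  have hswap := integral_integral_swap hint
  calc _ = ∫ s in box T, ∫ r, (Iic r).indicator (fun s => g s * ∏ j, k j (r j)) s ∂orthant n := by
        refine setIntegral_congr_fun (measurableSet_box T) fun s hs => ?_
        have h1 : ∀ r : Fin n → ℝ, (Iic r).indicator (fun s => g s * ∏ j, k j (r j)) s =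
            g s * ∏ j, (Ici (s j)).indicator (k j) (r j) := by
          intro r
          by_cases h : s ≤ r
          · rw [indicator_of_mem (by simpa using h)]
            congr 1
            exact Finset.prod_congr rfl fun j _ => (indicator_of_mem (by simpa using h j) _).symm
          · rw [indicator_of_notMem (by simpa using h)]
            obtain ⟨j, hj⟩ := not_forall.mp h
            rw [Finset.prod_eq_zero (Finset.mem_univ j), mul_zero]
            exact indicator_of_notMem (by simpa using hj) _
        simp only [h1]
        rw [integral_const_mul, integral_fintype_prod_eq_prod, mul_comm]
        congr 1
        refine Finset.prod_congr rfl fun j _ => ?_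
        rw [integral_indicator measurableSet_Ici, Measure.restrict_restrict measurableSet_Ici]
        congr 2
        refine (inter_eq_left.mpr fun x hx => ?_).symm
        exact lt_of_lt_of_le (hs j (mem_univ j)).1 hx
    _ = _ := by
        rw [hswap]
        refine integral_congr_ae (.of_forall fun r => ?_)
        simp only
        rw [integral_indicator measurableSet_Iic, Measure.restrict_restrict measurableSet_Iic,
          inter_comm, box_inter_Iic, integral_mul_const, mul_comm]

/-- The integral over the box `(0,t]` depends continuously on `t`. -/
lemma continuous_setIntegral_box {n : ℕ} {g : (Fin n → ℝ) → ℂ}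
    (hg : ∀ T, IntegrableOn g (box T)) : Continuous fun t => ∫ s in box t, g s := by
  rw [continuous_iff_continuousAt]
  intro t₀
  simp only [← integral_indicator (measurableSet_box _)]
  refine continuousAt_of_dominated
    (bound := fun s => ‖(box (fun i => t₀ i + 1)).indicator g s‖) ?_ ?_ ?_ ?_
  · exact .of_forall fun t =>
      ((integrable_indicator_iff (measurableSet_box t)).mpr (hg t)).aestronglyMeasurable
  · have : ∀ᶠ t in nhds t₀, ∀ i, t i < t₀ i + 1 := by
      rw [eventually_all]
      intro i
      exact (continuous_apply i).continuousAt.eventually_lt_const (by simp)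
    filter_upwards [this] with t ht
    refine .of_forall fun s => norm_indicator_le_of_subset ?_ _ _
    exact pi_mono fun i _ => Ioc_subset_Ioc_right (ht i).le
  · exact ((integrable_indicator_iff (measurableSet_box _)).mpr (hg _)).norm
  · have hne : ∀ᵐ s : Fin n → ℝ, ∀ i, s i ≠ t₀ i := by
      rw [ae_all_iff]
      intro i
      exact Measure.ae_eval_ne (fun _ : Fin n => (volume : Measure ℝ)) i (t₀ i)
    filter_upwards [hne] with s hs
    have : ∀ᶠ t in nhds t₀, (s ∈ box t ↔ s ∈ box t₀) := by
      have : ∀ᶠ t in nhds t₀, ∀ i, (s i ≤ t i ↔ s i ≤ t₀ i) := by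
        rw [eventually_all]
        intro i
        rcases (hs i).lt_or_gt with h | h
        · filter_upwards [(continuous_apply i).continuousAt.eventually_const_lt h] with t ht
          exact iff_of_true ht.le h.le
        · filter_upwards [(continuous_apply i).continuousAt.eventually_lt_const h] with t ht
          exact iff_of_false ht.not_ge h.not_ge
      filter_upwards [this] with t ht
      simp only [mem_univ_pi, mem_Ioc, ht]
    refine (continuousAt_const (y := (box t₀).indicator g s)).congr (this.mono fun t ht => ?_)
    exact (indicator_eq_indicator (s := box t) (t := box t₀) ht rfl).symm

/-- A function all of whose box integrals vanish is zero almost everywhere on each box. -/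
lemma ae_eq_zero_of_setIntegral_box_eq_zero {n : ℕ} {g : (Fin n → ℝ) → ℂ}
    (hg : ∀ T, IntegrableOn g (box T)) (h0 : ∀ t, ∫ s in box t, g s = 0) (T : Fin n → ℝ) :
    g =ᵐ[volume.restrict (box T)] 0 := by
  refine (hg T).ae_eq_zero_of_forall_setIntegral_eq_zero fun A hA hfin => ?_
  clear hfin
  have hpi : MeasurableSpace.generateFrom
      (Set.univ.pi '' Set.univ.pi fun _ : Fin n => range (Iic : ℝ → Set ℝ)) =
      MeasurableSpace.pi := by
    refine generateFrom_eq_pi (fun _ => ?_) fun _ => ?_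
    · rw [BorelSpace.measurable_eq (α := ℝ), borel_eq_generateFrom_Iic]
    · exact ⟨fun m : ℕ => Iic (m : ℝ), fun m => ⟨_, rfl⟩,
        eq_univ_of_forall fun x => mem_iUnion.mpr (exists_nat_ge x)⟩
  induction A, hA using MeasurableSpace.induction_on_inter hpi.symm
    (IsPiSystem.pi fun _ => by simpa using isPiSystem_image_Iic (univ : Set ℝ)) with
  | empty => simp
  | basic t ht =>
    obtain ⟨C, hC, rfl⟩ := ht
    choose r hr using fun i => hC i (mem_univ i)
    obtain rfl : (fun i => Iic (r i)) = C := funext hr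
    rw [pi_univ_Iic, Measure.restrict_restrict measurableSet_Iic, inter_comm, box_inter_Iic]
    exact h0 _
  | compl t ht ih =>
    have := integral_add_compl ht (hg T)
    rwa [ih, zero_add, h0] at this
  | iUnion f hd hm ih =>
    rw [integral_iUnion hm hd (hg T).integrableOn]
    simp [ih]

lemma ae_orthant_pos (n : ℕ) : ∀ᵐ r ∂orthant n, ∀ i, 0 < r i := by
  rw [orthant_eq_restrict]
  filter_upwards [ae_restrict_mem (MeasurableSet.univ_pi fun _ => measurableSet_Ioi)] with r hr
  exact fun i => hr i trivial

/-- The exponential `exp (μ s)` on `(0,T]` is the tail integral of a kernel of mass at most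
`2 exp (μ T)`. -/
lemma exists_kernel_tail_eq_exp {μ T : ℝ} (hμ : 0 < μ) (hT : 0 ≤ T) :
    ∃ k : ℝ → ℂ, Integrable k halfLine ∧
      (∀ s ∈ Ioc 0 T, ∫ r in Ici s, k r = Complex.exp (μ * s)) ∧
      ∫ r, ‖k r‖ ∂halfLine ≤ 2 * Real.exp (μ * T) := by
  have hμ' : (μ : ℂ) ≠ 0 := by exact_mod_cast hμ.ne'
  set a : ℝ → ℂ := (Ioc 0 T).indicator fun r => -(μ * Complex.exp (μ * r)) with ha
  set b : ℝ → ℂ := (Ioc T (T + 1)).indicator fun _ => Complex.exp (μ * T) with hb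
  have hai : Integrable a := by
    rw [ha, integrable_indicator_iff measurableSet_Ioc]
    exact Continuous.integrableOn_Ioc (by fun_prop)
  have hbi : Integrable b := by
    rw [hb, integrable_indicator_iff measurableSet_Ioc]
    exact Continuous.integrableOn_Ioc (by fun_prop)
  refine ⟨fun r => a r + b r, (hai.add hbi).restrict, fun s hs => ?_, ?_⟩
  · rw [integral_add hai.restrict hbi.restrict, ha, hb, setIntegral_indicator measurableSet_Ioc,
      setIntegral_indicator measurableSet_Ioc]
    have h1 : Ici s ∩ Ioc 0 T = Icc s T := by
      ext x; simp only [mem_inter_iff, mem_Ici, mem_Ioc, mem_Icc] at *; grind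
    have h2 : Ici s ∩ Ioc T (T + 1) = Ioc T (T + 1) := by
      ext x; simp only [mem_inter_iff, mem_Ici, mem_Ioc] at *; grind
    rw [h1, h2, integral_Icc_eq_integral_Ioc, ← intervalIntegral.integral_of_le hs.2,
      intervalIntegral.integral_neg, intervalIntegral.integral_const_mul,
      integral_exp_mul_complex hμ', mul_div_cancel₀ _ hμ']
    simp
  · have hnorm : ∀ z : ℝ, ‖Complex.exp (μ * z)‖ = Real.exp (μ * z) := fun z => by
      rw [← Complex.ofReal_mul, Complex.norm_exp_ofReal]
    have hA : ∫ r, ‖a r‖ ∂halfLine ≤ Real.exp (μ * T) := by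
      have : ∀ r, ‖a r‖ = (Ioc 0 T).indicator (fun r => μ * Real.exp (μ * r)) r := fun r => by
        rw [ha, norm_indicator_eq_indicator_norm]
        simp [hnorm, abs_of_pos hμ, indicator]
      simp only [this]
      rw [setIntegral_indicator measurableSet_Ioc,
        inter_eq_right.mpr (fun x hx => hx.1), ← intervalIntegral.integral_of_le hT,
        intervalIntegral.integral_const_mul, intervalIntegral.integral_comp_mul_left _ hμ.ne',
        integral_exp, smul_eq_mul, mul_inv_cancel_left₀ hμ.ne']
      simp
    have hB : ∫ r, ‖b r‖ ∂halfLine ≤ Real.exp (μ * T) := by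
      have : ∀ r, ‖b r‖ = (Ioc T (T + 1)).indicator (fun r => Real.exp (μ * T)) r := fun r => by
        rw [hb, norm_indicator_eq_indicator_norm]
        simp [hnorm, indicator]
      simp only [this]
      rw [setIntegral_indicator measurableSet_Ioc,
        inter_eq_right.mpr (Ioc_subset_Ioi_self.trans (Ioi_subset_Ioi hT))]
      simp
    calc ∫ r, ‖a r + b r‖ ∂halfLine ≤ ∫ r, (‖a r‖ + ‖b r‖) ∂halfLine :=
          integral_mono (hai.add hbi).norm.restrict (hai.norm.add hbi.norm).restrict
            fun r => norm_add_le _ _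
      _ = ∫ r, ‖a r‖ ∂halfLine + ∫ r, ‖b r‖ ∂halfLine :=
          integral_add hai.norm.restrict hbi.norm.restrict
      _ ≤ _ := by linarith

/-- Bounded partial Laplace integrals at a real point `μ` with positive entries give exponential
bounds for the box integrals. -/
lemma exists_norm_setIntegral_box_le {n : ℕ} {f : (Fin n → ℝ) → ℂ}
    (hf : ∀ T, IntegrableOn f (box T)) {μ : Fin n → ℝ} (hμ : ∀ j, 0 < μ j)
    (hb : (fun j => (μ j : ℂ)) ∈ mOmegaB n f) :
    ∃ C, ∀ t, (∀ i, 0 ≤ t i) → ‖∫ s in box t, f s‖ ≤ C * Real.exp (∑ j, μ j * t j) := by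
  rw [mOmegaB, mem_ofPred_eq] at hb
  obtain ⟨C, hC⟩ := hb.exists_norm_le
  refine ⟨C * 2 ^ n, fun T hT => ?_⟩
  choose k hki hktail hkmass using fun j => exists_kernel_tail_eq_exp (hμ j) (hT j)
  set g : (Fin n → ℝ) → ℂ := fun s => Complex.exp (-(∑ i, (μ i : ℂ) * s i)) * f s with hg
  have hgi : IntegrableOn g (box T) := by
    refine (hf T).continuousOn_mul_of_subset (K := Icc 0 T) (Continuous.continuousOn (by fun_prop))
      isCompact_Icc (measurableSet_box T) ?_
    exact fun s hs => ⟨fun i => (hs i trivial).1.le, fun i => (hs i trivial).2⟩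
  have hrep : ∫ s in box T, f s =
      ∫ r, (∏ j, k j (r j)) * (∫ s in box (r ⊓ T), g s) ∂orthant n := by
    rw [← setIntegral_box_prod_tail_mul hgi hki]
    refine setIntegral_congr_fun (measurableSet_box T) fun s hs => ?_
    simp only [hg]
    rw [Finset.prod_congr rfl fun j _ => hktail j (s j) (hs j trivial), ← Complex.exp_sum,
      ← mul_assoc, ← Complex.exp_add, add_neg_cancel, Complex.exp_zero, one_mul]
  have hprodi : Integrable (fun r : Fin n → ℝ => ∏ j, ‖k j (r j)‖) (orthant n) :=
    Integrable.fintype_prod fun j => (hki j).norm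
  have hC0 : 0 ≤ C := (norm_nonneg _).trans (hC _ ⟨0, by simp, rfl⟩)
  calc ‖∫ s in box T, f s‖ ≤ ∫ r, (∏ j, ‖k j (r j)‖) * C ∂orthant n := by
        rw [hrep]
        refine norm_integral_le_of_norm_le (hprodi.mul_const C) ?_
        filter_upwards [ae_orthant_pos n] with r hr
        rw [norm_mul, norm_prod]
        refine mul_le_mul_of_nonneg_left (hC _ ⟨r ⊓ T, fun i => le_inf (hr i).le (hT i), rfl⟩)
          (Finset.prod_nonneg fun _ _ => norm_nonneg _)
    _ = (∏ j, ∫ r, ‖k j r‖ ∂halfLine) * C := by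
        rw [integral_mul_const, integral_fintype_prod_eq_prod (fun j r => ‖k j r‖)]
    _ ≤ (∏ j, 2 * Real.exp (μ j * T j)) * C := by
        refine mul_le_mul_of_nonneg_right (Finset.prod_le_prod (fun j _ => ?_)
          fun j _ => hkmass j) hC0
        exact integral_nonneg fun _ => norm_nonneg _
    _ = C * 2 ^ n * Real.exp (∑ j, μ j * T j) := by
        rw [Finset.prod_mul_distrib, ← Real.exp_sum]
        simp
        ring

/-- A vanishing Laplace transform of `f` gives a vanishing, absolutely convergent, Laplace
transform of the box integrals of `f`. -/
lemma integral_exp_mul_setIntegral_box_eq_zero {n : ℕ} {f : (Fin n → ℝ) → ℂ}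
    (hf : ∀ T, IntegrableOn f (box T)) {μ : Fin n → ℝ} (hμ : ∀ j, 0 < μ j) {C : ℝ}
    (hC : ∀ t, (∀ i, 0 ≤ t i) → ‖∫ s in box t, f s‖ ≤ C * Real.exp (∑ j, μ j * t j))
    {l : Fin n → ℂ} (hl : ∀ j, μ j < (l j).re) (h0 : HasMLaplace n f l 0) :
    ∫ r, Complex.exp (-∑ j, l j * r j) * (∫ s in box r, f s) ∂orthant n = 0 := by
  have hlre : ∀ j, 0 < (l j).re := fun j => (hμ j).trans (hl j)
  have hl0 : ∀ j, l j ≠ 0 := fun j h => by have := hlre j; simp [h] at this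
  have hk : ∀ j, Integrable (fun r : ℝ => l j * Complex.exp (-l j * r)) halfLine := fun j =>
    (integrableOn_exp_mul_complex_Ioi (by simpa using hlre j) 0).const_mul _
  have hC0 : 0 ≤ C := by simpa using (norm_nonneg _).trans (hC 0 (by simp))
  have hrep : ∀ T, mLapPartial n f l T = ∫ r, (∏ j, l j * Complex.exp (-l j * r j)) *
      (∫ s in box (r ⊓ T), f s) ∂orthant n := by
    intro T
    rw [← setIntegral_box_prod_tail_mul (hf T) hk]
    refine setIntegral_congr_fun (measurableSet_box T) fun s _ => ?_
    congr 1
    rw [← Finset.sum_neg_distrib, Complex.exp_sum]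
    refine Finset.prod_congr rfl fun j _ => ?_
    rw [integral_Ici_eq_integral_Ioi, integral_const_mul,
      integral_exp_mul_complex_Ioi (by simpa using hlre j)]
    field_simp [hl0 j]
  have hbound : Integrable (fun r : Fin n → ℝ =>
      (∏ j, ‖l j‖ * Real.exp ((μ j - (l j).re) * r j)) * C) (orthant n) :=
    (Integrable.fintype_prod fun j => (integrableOn_exp_mul_Ioi
      (sub_neg.mpr (hl j)) 0).const_mul ‖l j‖).mul_const C
  have hseq : Tendsto (fun (m : ℕ) (_ : Fin n) => (m : ℝ)) atTop atTop :=
    tendsto_atTop.mpr fun b => by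
      have : ∀ᶠ m : ℕ in atTop, ∀ i, b i ≤ m := by
        rw [eventually_all]
        exact fun i => tendsto_natCast_atTop_atTop.eventually_ge_atTop _
      exact this
  have hcont := continuous_setIntegral_box hf
  have hlim : Tendsto (fun m : ℕ => mLapPartial n f l fun _ => (m : ℝ)) atTop
      (nhds (∫ r, (∏ j, l j * Complex.exp (-l j * r j)) *
        (∫ s in box r, f s) ∂orthant n)) := by
    simp only [hrep]
    refine tendsto_integral_of_dominated_convergence _ (fun m => ?_) hbound (fun m => ?_) ?_
    · refine Continuous.aestronglyMeasurable (Continuous.mul (by fun_prop) ?_)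
      exact hcont.comp (continuous_pi fun i => (continuous_apply i).min continuous_const)
    · filter_upwards [ae_orthant_pos n] with r hr
      rw [norm_mul, norm_prod]
      have hF : ‖∫ s in box (r ⊓ fun _ => (m : ℝ)), f s‖ ≤ C * ∏ j, Real.exp (μ j * r j) := by
        refine (hC _ fun i => le_inf (hr i).le (Nat.cast_nonneg m)).trans ?_
        rw [← Real.exp_sum]
        gcongr with j
        · exact (hμ j).le
        · exact inf_le_left
      refine (mul_le_mul_of_nonneg_left hF (Finset.prod_nonneg fun _ _ => norm_nonneg _)).trans
        (le_of_eq ?_)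
      rw [mul_comm C, ← mul_assoc, ← Finset.prod_mul_distrib]
      congr 1
      refine Finset.prod_congr rfl fun j _ => ?_
      rw [norm_mul, Complex.norm_exp, mul_assoc, ← Real.exp_add]
      congr 2
      simp
      ring
    · refine .of_forall fun r => tendsto_const_nhds.congr' ?_
      filter_upwards [hseq.eventually_ge_atTop r] with m hm
      rw [inf_eq_left.mpr hm]
  have heq := tendsto_nhds_unique hlim (h0.comp hseq)
  simp only [Finset.prod_mul_distrib, ← Complex.exp_sum, mul_assoc] at heq
  rw [integral_const_mul] at heq
  simpa [Finset.prod_eq_zero_iff, hl0] using heq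

lemma integrable_exp_sum_orthant {n : ℕ} {a : Fin n → ℝ} (ha : ∀ j, a j < 0) :
    Integrable (fun r => Real.exp (∑ j, a j * r j)) (orthant n) := by
  simp only [Real.exp_sum]
  exact Integrable.fintype_prod fun j => integrableOn_exp_mul_Ioi (ha j) 0

lemma norm_cexp_neg_sum {n : ℕ} (l : Fin n → ℂ) (r : Fin n → ℝ) :
    ‖Complex.exp (-∑ j, l j * r j)‖ = Real.exp (-∑ j, (l j).re * r j) := by
  simp [Complex.norm_exp]

/-- Pointwise bound of the Laplace integrand of an exponentially bounded function. -/
lemma norm_cexp_mul_le {n : ℕ} {l : Fin n → ℂ} {μ r : Fin n → ℝ} {z : ℂ} {C : ℝ}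
    (hz : ‖z‖ ≤ C * Real.exp (∑ j, μ j * r j)) :
    ‖Complex.exp (-∑ j, l j * r j) * z‖ ≤ C * Real.exp (∑ j, (μ j - (l j).re) * r j) := by
  rw [norm_mul, norm_cexp_neg_sum]
  refine (mul_le_mul_of_nonneg_left hz (Real.exp_nonneg _)).trans (le_of_eq ?_)
  rw [mul_left_comm, ← Real.exp_add]
  congr 2
  simp only [sub_mul, Finset.sum_sub_distrib]
  ring

lemma integrable_cexp_mul_orthant {n : ℕ} {F : (Fin n → ℝ) → ℂ} (hF : StronglyMeasurable F)
    {μ : Fin n → ℝ} {C : ℝ}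
    (hC : ∀ t, (∀ i, 0 < t i) → ‖F t‖ ≤ C * Real.exp (∑ j, μ j * t j))
    {l : Fin n → ℂ} (hl : ∀ j, μ j < (l j).re) :
    Integrable (fun r => Complex.exp (-∑ j, l j * r j) * F r) (orthant n) := by
  refine ((integrable_exp_sum_orthant fun j => sub_neg.mpr (hl j)).const_mul C).mono'
    ((Continuous.aestronglyMeasurable (by fun_prop)).mul hF.aestronglyMeasurable) ?_
  filter_upwards [ae_orthant_pos n] with r hr
  exact norm_cexp_mul_le (hC r hr)

/-- Integrability of the Laplace integrand gives convergence of the partial Laplace integrals. -/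
lemma hasLaplace_integral_halfLine {f : ℝ → ℂ} {l : ℂ}
    (h : Integrable (fun s : ℝ => Complex.exp (-(l * s)) * f s) halfLine) :
    HasLaplace f l (∫ s : ℝ, Complex.exp (-(l * s)) * f s ∂halfLine) := by
  refine (intervalIntegral_tendsto_integral_Ioi 0 h tendsto_id).congr' ?_
  filter_upwards [eventually_ge_atTop 0] with t ht
  exact intervalIntegral.integral_of_le ht

lemma IsUniquenessSeq.ae_eq_zero {lam : ℕ → ℂ} (hu : IsUniquenessSeq lam) {ω : ℝ}
    (hω : ∀ k, ω < (lam k).re) {H : ℝ → ℂ} (hH : StronglyMeasurable H)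
    (hb : ∀ μ, ω < μ → ∃ C, ∀ t, 0 < t → ‖H t‖ ≤ C * Real.exp (μ * t))
    (h0 : ∀ k, ∫ s : ℝ, Complex.exp (-(lam k * s)) * H s ∂halfLine = 0) :
    ∀ᵐ t ∂halfLine, H t = 0 := by
  have hint : ∀ l : ℂ, ω < l.re →
      Integrable (fun s : ℝ => Complex.exp (-(l * s)) * H s) halfLine := by
    intro l hl
    obtain ⟨μ, hμ, hμl⟩ := exists_between hl
    obtain ⟨C, hC⟩ := hb μ hμ
    refine ((integrableOn_exp_mul_Ioi (sub_neg.mpr hμl) 0).const_mul C).mono'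
      ((Continuous.aestronglyMeasurable (by fun_prop)).mul hH.aestronglyMeasurable) ?_
    filter_upwards [ae_restrict_mem measurableSet_Ioi] with s hs
    rw [norm_mul, Complex.norm_exp]
    refine (mul_le_mul_of_nonneg_left (hC s hs) (Real.exp_nonneg _)).trans (le_of_eq ?_)
    rw [mul_left_comm, ← Real.exp_add]
    congr 2
    simp
    ring
  have hloc : LocallyIntegrableOn H (Ici 0) := by
    have h1 : IntegrableOn (fun s : ℝ => Complex.exp (-((ω + 1 : ℂ) * s)) * H s) (Ici 0) :=
      (integrableOn_Ici_iff_integrableOn_Ioi (by simp)).mpr (hint (ω + 1) (by simp))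
    refine (h1.locallyIntegrableOn.continuousOn_mul (g := fun s : ℝ => Complex.exp ((ω + 1 : ℂ) * s))
      (Continuous.continuousOn (by fun_prop)) isClosed_Ici.isLocallyClosed).congr ?_
    refine .of_forall fun s => ?_
    simp only
    rw [← mul_assoc, ← Complex.exp_add, add_neg_cancel, Complex.exp_zero, one_mul]
  have habs : laplaceAbs H ≤ ω :=
    sInf_le ⟨ω, rfl, fun l hl => ⟨_, hasLaplace_integral_halfLine (hint l hl)⟩⟩
  have := hu H hloc (fun k => habs.trans_lt (by exact_mod_cast hω k)) fun k => by
    simpa [h0 k] using hasLaplace_integral_halfLine (hint (lam k) (hω k))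
  rw [ae_restrict_iff' measurableSet_Ioi]
  exact this.mono fun t ht h => ht (le_of_lt h)

lemma measurePreserving_cons_orthant (n : ℕ) :
    MeasurePreserving (fun z : ℝ × (Fin n → ℝ) => (Fin.cons z.1 z.2 : Fin (n + 1) → ℝ))
      (halfLine.prod (orthant n)) (orthant (n + 1)) := by
  have h := (measurePreserving_piFinSuccAbove (fun _ : Fin (n + 1) => halfLine) 0).symm
  convert h using 1
  ext z i
  simp

/-- A product of uniqueness sequences detects exponentially bounded functions on the orthant. -/
lemma ae_eq_zero_of_isUniquenessSeq (n : ℕ) : ∀ {lam : Fin n → ℕ → ℂ}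
    (_ : ∀ j, IsUniquenessSeq (lam j)) {ω : Fin n → ℝ} (_ : ∀ j k, ω j < (lam j k).re)
    {F : (Fin n → ℝ) → ℂ} (_ : StronglyMeasurable F)
    (_ : ∀ μ : Fin n → ℝ, (∀ j, ω j < μ j) →
      ∃ C, ∀ t, (∀ i, 0 < t i) → ‖F t‖ ≤ C * Real.exp (∑ j, μ j * t j))
    (_ : ∀ k : Fin n → ℕ, ∫ r, Complex.exp (-∑ j, lam j (k j) * r j) * F r ∂orthant n = 0),
    ∀ᵐ r ∂orthant n, F r = 0 := by
  induction n with
  | zero =>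
    intro lam _ ω _ F _ _ h0
    have h := h0 0
    simp only [Finset.univ_eq_empty, Finset.sum_empty, neg_zero, Complex.exp_zero, one_mul,
      Measure.pi_of_empty _ (0 : Fin 0 → ℝ), integral_dirac] at h
    exact .of_forall fun r => by rw [Subsingleton.elim r 0, h]
  | succ n ih =>
    intro lam hu ω hω F hF hb h0
    have hmp := measurePreserving_cons_orthant n
    have hcons : StronglyMeasurable fun z : ℝ × (Fin n → ℝ) => F (Fin.cons z.1 z.2) :=
      hF.comp_measurable hmp.measurable
    set H : (Fin n → ℕ) → ℝ → ℂ := fun k x =>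
      ∫ y, Complex.exp (-∑ j, lam j.succ (k j) * y j) * F (Fin.cons x y) ∂orthant n with hH
    have hHm : ∀ k, StronglyMeasurable (H k) := fun k =>
      StronglyMeasurable.integral_prod_right
        (f := fun x y => Complex.exp (-∑ j, lam j.succ (k j) * y j) * F (Fin.cons x y))
        ((Continuous.stronglyMeasurable (by fun_prop)).mul hcons)
    have hslice : ∀ μ : Fin (n + 1) → ℝ, (∀ j, ω j < μ j) → ∃ C, ∀ x y, 0 < x →
        (∀ i, 0 < y i) → ‖F (Fin.cons x y)‖ ≤
          C * Real.exp (μ 0 * x) * Real.exp (∑ j : Fin n, μ j.succ * y j) := by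
      intro μ hμ
      obtain ⟨C, hC⟩ := hb μ hμ
      refine ⟨C, fun x y hx hy => ?_⟩
      have := hC (Fin.cons x y) (Fin.cases hx hy)
      rwa [Fin.sum_univ_succ, Real.exp_add, ← mul_assoc] at this
    have hH0 : ∀ k, ∀ᵐ x ∂halfLine, H k x = 0 := by
      intro k
      choose μ' hμ' hμl using fun j : Fin n => exists_between (hω j.succ (k j))
      refine (hu 0).ae_eq_zero (hω 0) (hHm k) (fun μ₀ hμ₀ => ?_) fun k₀ => ?_
      · obtain ⟨C, hC⟩ := hslice (Fin.cons μ₀ μ') (Fin.cases hμ₀ hμ')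
        refine ⟨C * ∫ y, Real.exp (∑ j, (μ' j - (lam j.succ (k j)).re) * y j) ∂orthant n,
          fun x hx => ?_⟩
        rw [mul_right_comm, ← integral_const_mul]
        refine norm_integral_le_of_norm_le
          ((integrable_exp_sum_orthant fun j => sub_neg.mpr (hμl j)).const_mul _) ?_
        filter_upwards [ae_orthant_pos n] with y hy
        exact norm_cexp_mul_le (l := fun j => lam j.succ (k j)) (hC x y hx hy)
      · have hint : Integrable (fun r => Complex.exp (-∑ j, lam j ((Fin.cons k₀ k :
            Fin (n + 1) → ℕ) j) * r j) * F r) (orthant (n + 1)) := by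
          obtain ⟨μ₀, hμ₀, hμl₀⟩ := exists_between (hω 0 k₀)
          obtain ⟨C, hC⟩ := hb (Fin.cons μ₀ μ') (Fin.cases hμ₀ hμ')
          exact integrable_cexp_mul_orthant hF hC
            (l := fun j => lam j ((Fin.cons k₀ k : Fin (n + 1) → ℕ) j)) (Fin.cases hμl₀ hμl)
        have h := h0 (Fin.cons k₀ k)
        have hint' := (hmp.integrable_comp hint.aestronglyMeasurable).mpr hint
        rw [← hmp.map_eq, integral_map hmp.aemeasurable
          (hmp.map_eq.symm ▸ hint.aestronglyMeasurable)] at h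
        rw [← h]
        refine ((integral_prod _ hint').trans ?_).symm
        refine integral_congr_ae (.of_forall fun x => ?_)
        simp only [hH, ← integral_const_mul, Function.comp_apply]
        refine integral_congr_ae (.of_forall fun y => ?_)
        simp only [Fin.sum_univ_succ, Fin.cons_zero, Fin.cons_succ, neg_add, Complex.exp_add]
        ring
    have hm0 : MeasurableSet {r | F r = 0} := hF.measurable (measurableSet_singleton 0)
    rw [← hmp.map_eq, ae_map_iff hmp.aemeasurable hm0]
    refine (Measure.ae_prod_iff_ae_ae (hmp.measurable hm0)).mpr ?_
    filter_upwards [ae_all_iff.mpr hH0, ae_restrict_mem measurableSet_Ioi] with x hx hx0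
    refine ih (fun j => hu j.succ) (fun j k => hω j.succ k)
      (hcons.comp_measurable measurable_prodMk_left) (fun μ' hμ' => ?_) hx
    obtain ⟨C, hC⟩ := hslice (Fin.cons (ω 0 + 1) μ') (Fin.cases (by simp) hμ')
    exact ⟨_, fun y hy => hC x y hx0 hy⟩

lemma integrableOn_box_of_locallyIntegrableOn {n : ℕ} {f : (Fin n → ℝ) → ℂ}
    (hf : LocallyIntegrableOn f {t | ∀ i, 0 ≤ t i}) (T : Fin n → ℝ) : IntegrableOn f (box T) := by
  refine (hf.integrableOn_compact_subset (t := Icc 0 T) (fun s hs i => hs.1 i)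
    isCompact_Icc).mono_set fun s hs => ?_
  exact ⟨fun i => (hs i trivial).1.le, fun i => (hs i trivial).2⟩

lemma isMUniquenessFamily_of_isUniquenessSeq {n : ℕ} {lam : Fin n → ℕ → ℂ}
    (hre : ∀ j k, 0 < (lam j k).re) (hu : ∀ j, IsUniquenessSeq (lam j)) :
    IsMUniquenessFamily n (fun (k : Fin n → ℕ) j => lam j (k j)) := by
  rintro f hloc ⟨ω, hωtop, hsub, hωl⟩ h0
  have hf := integrableOn_box_of_locallyIntegrableOn hloc
  set ω' : Fin n → ℝ := fun j => max (ω j).toReal 0 with hω'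
  have hω'l : ∀ j k, ω' j < (lam j k).re := by
    refine fun j k => max_lt ?_ (hre j k)
    have h := hωl (fun _ => k) j
    induction hx : ω j with
    | bot => simpa using hre j k
    | top => exact absurd hx (hωtop j)
    | coe x => rw [hx] at h; simpa using h
  have hbound : ∀ μ : Fin n → ℝ, (∀ j, ω' j < μ j) → ∃ C, ∀ t, (∀ i, 0 ≤ t i) →
      ‖∫ s in box t, f s‖ ≤ C * Real.exp (∑ j, μ j * t j) := by
    refine fun μ hμ => exists_norm_setIntegral_box_le hf
      (fun j => (le_max_right _ _).trans_lt (hμ j)) (hsub fun j => ?_).1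
    refine (EReal.le_coe_toReal (hωtop j)).trans_lt ?_
    rw [Complex.ofReal_re, EReal.coe_lt_coe_iff]
    exact (le_max_left _ _).trans_lt (hμ j)
  have hcont := continuous_setIntegral_box hf
  have hae : ∀ᵐ r ∂orthant n, ∫ s in box r, f s = 0 := by
    refine ae_eq_zero_of_isUniquenessSeq n hu hω'l hcont.stronglyMeasurable (fun μ hμ => ?_)
      fun k => ?_
    · obtain ⟨C, hC⟩ := hbound μ hμ
      exact ⟨C, fun t ht => hC t fun i => (ht i).le⟩
    · choose μ hμ hμl using fun j => exists_between (hω'l j (k j))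
      obtain ⟨C, hC⟩ := hbound μ hμ
      exact integral_exp_mul_setIntegral_box_eq_zero hf
        (fun j => (le_max_right _ _).trans_lt (hμ j)) hC hμl (h0 k)
  have hzero : ∀ t, ∫ s in box t, f s = 0 := by
    intro t
    by_cases ht : ∀ i, 0 < t i
    · rw [orthant_eq_restrict] at hae
      exact Measure.eqOn_open_of_ae_eq hae (isOpen_set_pi finite_univ fun _ _ => isOpen_Ioi)
        hcont.continuousOn continuousOn_const fun i _ => ht i
    · obtain ⟨i, hi⟩ := not_forall.mp ht
      have : box t = ∅ := univ_pi_eq_empty (i := i) (Ioc_eq_empty hi)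
      simp [this]
  have hpos : ∀ᵐ t : Fin n → ℝ, ∀ i, t i ≠ 0 := by
    rw [ae_all_iff]
    exact fun i => Measure.ae_eval_ne (fun _ : Fin n => (volume : Measure ℝ)) i 0
  have hall : ∀ᵐ t : Fin n → ℝ, ∀ m : ℕ, t ∈ box (fun _ => (m : ℝ)) → f t = 0 := by
    rw [ae_all_iff]
    exact fun m => (ae_restrict_iff' (measurableSet_box _)).mp
      (ae_eq_zero_of_setIntegral_box_eq_zero hf hzero _)
  filter_upwards [hpos, hall] with t ht0 ht hnonneg
  obtain ⟨m, hm⟩ := exists_nat_ge (∑ i, t i)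
  refine ht m fun i _ => ⟨lt_of_le_of_ne (hnonneg i) (ht0 i).symm, le_trans ?_ hm⟩
  exact Finset.single_le_sum (fun i _ => hnonneg i) (Finset.mem_univ i)

lemma integrableOn_lapIntegrand {f : ℝ → ℂ} (hf : LocallyIntegrableOn f (Ici 0)) (l : ℂ) (t : ℝ) :
    IntegrableOn (fun s : ℝ => Complex.exp (-(l * s)) * f s) (Ioc 0 t) :=
  ((hf.integrableOn_compact_subset Icc_subset_Ici_self isCompact_Icc).continuousOn_mul
    (Continuous.continuousOn (by fun_prop)) isCompact_Icc).mono_set Ioc_subset_Icc_self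

/-- Convergent partial Laplace integrals are bounded. -/
lemma HasLaplace.exists_norm_le {f : ℝ → ℂ} (hf : LocallyIntegrableOn f (Ici 0)) {l F : ℂ}
    (h : HasLaplace f l F) : ∃ C, ∀ t, ‖lapPartial f l t‖ ≤ C := by
  obtain ⟨T, hT⟩ := eventually_atTop.mp (h.norm.eventually_lt_const (lt_add_one ‖F‖))
  refine ⟨max (‖F‖ + 1) (∫ s in Ioc 0 T, ‖Complex.exp (-(l * s)) * f s‖), fun t => ?_⟩
  rcases le_total T t with htT | htT
  · exact (hT t htT).le.trans (le_max_left _ _)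
  · refine (norm_integral_le_integral_norm _).trans (le_trans ?_ (le_max_right _ _))
    exact setIntegral_mono_set (integrableOn_lapIntegrand hf l T).norm
      (.of_forall fun _ => norm_nonneg _) (Ioc_subset_Ioc_right htT).eventuallyLE

/-- Partial Laplace integrals of a tensor product factorize. -/
lemma mLapPartial_prod {n : ℕ} (g : Fin n → ℝ → ℂ) (l : Fin n → ℂ) (t : Fin n → ℝ) :
    mLapPartial n (fun s => ∏ i, g i (s i)) l t = ∏ i, lapPartial (g i) (l i) (t i) := by
  simp only [mLapPartial, lapPartial, volume_pi, Measure.restrict_pi_pi]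
  rw [← integral_fintype_prod_eq_prod fun i (s : ℝ) => Complex.exp (-(l i * s)) * g i s]
  simp only [Finset.prod_mul_distrib, ← Complex.exp_sum, Finset.sum_neg_distrib]

lemma hasMLaplace_prod {n : ℕ} {g : Fin n → ℝ → ℂ} {l F : Fin n → ℂ}
    (h : ∀ i, HasLaplace (g i) (l i) (F i)) :
    HasMLaplace n (fun s => ∏ i, g i (s i)) l (∏ i, F i) := by
  refine Tendsto.congr (fun t => (mLapPartial_prod g l t).symm) ?_
  refine tendsto_finsetProd _ fun i _ => (h i).comp ?_
  exact tendsto_atTop.mpr fun b => (eventually_ge_atTop (fun _ => b)).mono fun t ht => ht i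

lemma locallyIntegrableOn_prod {n : ℕ} {g : Fin n → ℝ → ℂ}
    (hg : ∀ i, LocallyIntegrableOn (g i) (Ici 0)) :
    LocallyIntegrableOn (fun s : Fin n → ℝ => ∏ i, g i (s i)) {t | ∀ i, 0 ≤ t i} := by
  have hcl : IsClosed {t : Fin n → ℝ | ∀ i, 0 ≤ t i} := isClosed_Ici (a := (0 : Fin n → ℝ))
  rw [locallyIntegrableOn_iff hcl.isLocallyClosed]
  intro K hK hKc
  choose b hb using fun i => (hKc.image (continuous_apply i)).bddAbove
  have hbox : IntegrableOn (fun s : Fin n → ℝ => ∏ i, g i (s i))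
      (Set.pi Set.univ fun i => Icc 0 (b i)) := by
    rw [IntegrableOn, volume_pi, Measure.restrict_pi_pi]
    exact Integrable.fintype_prod fun i =>
      (hg i).integrableOn_compact_subset Icc_subset_Ici_self isCompact_Icc
  exact hbox.mono_set fun s hs i _ => ⟨hK hs i, hb i ⟨s, hs, rfl⟩⟩

lemma exists_hasLaplace_of_laplaceAbs_lt {f : ℝ → ℂ} {l : ℂ}
    (h : laplaceAbs f < ((l.re : ℝ) : EReal)) : ∃ F, HasLaplace f l F := by
  obtain ⟨_, ⟨ω, rfl, hω⟩, hlt⟩ := sInf_lt_iff.mp h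
  exact hω l (by exact_mod_cast hlt)

lemma exists_hasLaplace_exp_neg {l : ℂ} (hl : 0 < l.re) :
    ∃ F, HasLaplace (fun s : ℝ => Complex.exp (-s)) l F := by
  refine ⟨_, hasLaplace_integral_halfLine
    ((integrableOn_exp_mul_complex_Ioi (a := -(l + 1)) ?_ 0).congr ?_)⟩
  · simp; linarith
  · refine .of_forall fun s => ?_
    simp only
    rw [← Complex.exp_add]
    congr 1
    ring

lemma isUniquenessSeq_of_isMUniquenessFamily {n : ℕ} {lam : Fin n → ℕ → ℂ}
    (hre : ∀ j k, 0 < (lam j k).re)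
    (hM : IsMUniquenessFamily n (fun (k : Fin n → ℕ) j => lam j (k j))) (j : Fin n) :
    IsUniquenessSeq (lam j) := by
  intro f hf habs h0
  set g : Fin n → ℝ → ℂ := Function.update (fun _ s => Complex.exp (-s)) j f with hg
  have hgj : g j = f := Function.update_self ..
  have hgi : ∀ i, i ≠ j → g i = fun s : ℝ => Complex.exp (-s) := fun i hi =>
    Function.update_of_ne hi ..
  set ω : Fin n → EReal := Function.update (fun _ => 0) j (laplaceAbs f) with hω
  have hωj : ω j = laplaceAbs f := Function.update_self ..
  have hωi : ∀ i, i ≠ j → ω i = 0 := fun i hi => Function.update_of_ne hi ..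
  have hgloc : ∀ i, LocallyIntegrableOn (g i) (Ici 0) := by
    intro i
    by_cases hi : i = j
    · rw [hi, hgj]
      exact hf
    · rw [hgi i hi]
      exact (Continuous.locallyIntegrable (by fun_prop)).locallyIntegrableOn _
  have hlap : ∀ i (l : ℂ), ω i < ((l.re : ℝ) : EReal) → ∃ F, HasLaplace (g i) l F := by
    intro i l hl
    by_cases hi : i = j
    · subst hi
      rw [hgj]
      exact exists_hasLaplace_of_laplaceAbs_lt (hωj ▸ hl)
    · rw [hgi i hi]
      rw [hωi i hi] at hl
      exact exists_hasLaplace_exp_neg (by exact_mod_cast hl)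
  have hωlam : ∀ (k : Fin n → ℕ) i, ω i < (((lam i (k i)).re : ℝ) : EReal) := by
    intro k i
    by_cases hi : i = j
    · subst hi
      rw [hωj]
      exact habs _
    · rw [hωi i hi]
      exact_mod_cast hre i (k i)
  have hae := hM (fun s => ∏ i, g i (s i)) (locallyIntegrableOn_prod hgloc)
    ⟨ω, fun i => (hωlam 0 i).ne_top, fun l hl => ?_, hωlam⟩ fun k => ?_
  · have hsub : (Set.pi Set.univ fun i => {x : ℝ | 0 ≤ x ∧ (i = j → f x ≠ 0)}) ⊆
        {t : Fin n → ℝ | ¬ ((∀ i, 0 ≤ t i) → ∏ i, g i (t i) = 0)} := by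
      intro t ht h
      obtain ⟨i, -, hi⟩ := Finset.prod_eq_zero_iff.mp (h fun i => (ht i trivial).1)
      by_cases hij : i = j
      · subst hij
        exact (ht i trivial).2 rfl (hgj ▸ hi)
      · rw [hgi i hij] at hi
        exact Complex.exp_ne_zero _ hi
    have hnull := measure_mono_null hsub hae
    rw [volume_pi, Measure.pi_pi, Finset.prod_eq_zero_iff] at hnull
    obtain ⟨i, -, hi⟩ := hnull
    by_cases hij : i = j
    · rw [ae_iff]
      simpa [hij] using hi
    · have : {x : ℝ | 0 ≤ x ∧ (i = j → f x ≠ 0)} = Ici 0 := by ext x; simp [hij]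
      simp [this] at hi
  · choose F hF using fun i => hlap i (l i) (hl i)
    refine ⟨?_, _, hasMLaplace_prod hF⟩
    choose C hC using fun i => (hF i).exists_norm_le (hgloc i)
    refine (isBounded_iff_forall_norm_le (E := ℂ)).mpr ⟨∏ i, C i, ?_⟩
    rintro _ ⟨t, -, rfl⟩
    rw [mLapPartial_prod, norm_prod]
    exact Finset.prod_le_prod (fun _ _ => norm_nonneg _) fun i _ => hC i (t i)
  · choose F hF using fun i => hlap i (lam i (k i)) (hωlam k i)
    have hFj : F j = 0 := tendsto_nhds_unique (hF j) (hgj ▸ h0 (k j))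
    have := hasMLaplace_prod hF
    rwa [Finset.prod_eq_zero (Finset.mem_univ j) hFj] at this

theorem stmt8 (n : ℕ) (lam : Fin n → ℕ → ℂ) (hre : ∀ j k, 0 < (lam j k).re) :
    (∀ j, IsUniquenessSeq (lam j)) ↔
      IsMUniquenessFamily n (fun (k : Fin n → ℕ) j => lam j (k j)) := by
  exact ⟨isMUniquenessFamily_of_isUniquenessSeq hre, isUniquenessSeq_of_isMUniquenessFamily hre⟩

end
end
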